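/- Closed form of the UKF gain for linear systems: P_z^UKF = C·A·P·Aᵀ·Cᵀ + R is positive definite (hence invertible), and K^UKF := P_ez^UKF·(P_z^UKF)⁻¹ = (P_prior·Cᵀ − Q·Cᵀ)·(C·P_prior·Cᵀ + R − C·Q·Cᵀ)⁻¹. -/

import Mathlib

open Matrix

/-- UKF weight vector `W ∈ ℝ^{2n+1}`. -/
noncomputable def ukfW (n : ℕ) (α : ℝ) : Fin (2*n+1) → ℝ :=
  fun i => if i.val = 0 then (α^2 - 1)/α^2 else 1/(2*α^2*n)

/-- Perturbation matrix `Δ(α, B)`: first column 0, next n columns `α·bᵢ`,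
last n columns `−α·bᵢ`. -/
noncomputable def ukfDelta (n : ℕ) (α : ℝ) (B : Matrix (Fin n) (Fin n) ℝ) :
    Matrix (Fin n) (Fin (2*n+1)) ℝ :=
  Matrix.of fun i j =>
    if h0 : j.val = 0 then 0
    else if h1 : j.val ≤ n then α * B i ⟨j.val - 1, by omega⟩
    else -(α * B i ⟨j.val - n - 1, by have := j.isLt; omega⟩)

/-- Sigma-point matrix `X(x̂, α, B)`: j-th column is `x̂` plus the j-th column of `Δ(α, B)`. -/
noncomputable def sigmaPts {n : ℕ} (xhat : Fin n → ℝ) (α : ℝ)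
    (B : Matrix (Fin n) (Fin n) ℝ) : Matrix (Fin n) (Fin (2*n+1)) ℝ :=
  Matrix.of fun i j => xhat i + ukfDelta n α B i j

/-- Affine propagation of an ensemble: j-th column of the result is `A·(j-th column of X) + u`. -/
noncomputable def propagate {n : ℕ} (A : Matrix (Fin n) (Fin n) ℝ) (u : Fin n → ℝ)
    (X : Matrix (Fin n) (Fin (2*n+1)) ℝ) : Matrix (Fin n) (Fin (2*n+1)) ℝ :=
  Matrix.of fun i j => A.mulVec (fun r => X r j) i + u i

/-- Deviation matrix `X̃ = X − (X·W)·1ᵀ`. -/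
noncomputable def devMat {q m : ℕ} (w : Fin m → ℝ) (X : Matrix (Fin q) (Fin m) ℝ) :
    Matrix (Fin q) (Fin m) ℝ :=
  X - Matrix.vecMulVec (X.mulVec w) (fun _ => 1)

/-- Posterior covariance as a function of the gain:
`P(K̂) = P_prior + K̂·R̄·K̂ᵀ − K̂·C·P_prior − P_prior·Cᵀ·K̂ᵀ`. -/
noncomputable def postCov {n p : ℕ} (Pprior : Matrix (Fin n) (Fin n) ℝ)
    (C : Matrix (Fin p) (Fin n) ℝ) (Rbar : Matrix (Fin p) (Fin p) ℝ)
    (K : Matrix (Fin n) (Fin p) ℝ) : Matrix (Fin n) (Fin n) ℝ :=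
  Pprior + K * Rbar * Kᵀ - K * C * Pprior - Pprior * Cᵀ * Kᵀ

lemma sum_fin_two_mul_add_one {n : ℕ} (f : Fin (2*n+1) → ℝ) :
    ∑ j, f j = f 0 + ∑ i : Fin n, (f ⟨i.val + 1, by omega⟩ + f ⟨n + i.val + 1, by omega⟩) := by
  have h : 2 * n = n + n := two_mul n
  rw [Fin.sum_univ_succ, Finset.sum_add_distrib, ← Equiv.sum_comp (finCongr h.symm),
    Fin.sum_univ_add]
  rfl

lemma sum_ukfW {n : ℕ} (hn : 0 < n) {α : ℝ} (hα : α ≠ 0) : ∑ j, ukfW n α j = 1 := by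
  have hn' : (n : ℝ) ≠ 0 := by exact_mod_cast hn.ne'
  rw [sum_fin_two_mul_add_one]
  simp [ukfW]
  field_simp
  ring

lemma ukfDelta_zero {n : ℕ} (α : ℝ) (B : Matrix (Fin n) (Fin n) ℝ) (i : Fin n) :
    ukfDelta n α B i 0 = 0 := by
  simp [ukfDelta]

lemma ukfDelta_left {n : ℕ} (α : ℝ) (B : Matrix (Fin n) (Fin n) ℝ) (i k : Fin n)
    (h : k.val + 1 < 2*n+1) : ukfDelta n α B i ⟨k.val + 1, h⟩ = α * B i k := by
  have hk : k.val + 1 ≤ n := k.isLt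
  simp [ukfDelta, hk]

lemma ukfDelta_right {n : ℕ} (α : ℝ) (B : Matrix (Fin n) (Fin n) ℝ) (i k : Fin n)
    (h : n + k.val + 1 < 2*n+1) : ukfDelta n α B i ⟨n + k.val + 1, h⟩ = -(α * B i k) := by
  have hk : ¬ n + k.val + 1 ≤ n := by omega
  have he : n + k.val + 1 - n - 1 = k.val := by omega
  simp [ukfDelta, hk, he]

lemma ukfDelta_mulVec_ukfW {n : ℕ} (α : ℝ) (B : Matrix (Fin n) (Fin n) ℝ) :
    ukfDelta n α B *ᵥ ukfW n α = 0 := by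
  ext i
  simp only [mulVec, dotProduct]
  rw [sum_fin_two_mul_add_one]
  simp [ukfDelta_zero, ukfDelta_left, ukfDelta_right, ukfW]

lemma ukfDelta_mul_diagonal_mul_transpose {n : ℕ} (hn : 0 < n) {α : ℝ} (hα : α ≠ 0)
    (B : Matrix (Fin n) (Fin n) ℝ) :
    ukfDelta n α B * diagonal (ukfW n α) * (ukfDelta n α B)ᵀ = (n : ℝ)⁻¹ • (B * Bᵀ) := by
  have hn' : (n : ℝ) ≠ 0 := by exact_mod_cast hn.ne'
  ext i j
  rw [mul_apply, sum_fin_two_mul_add_one]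
  simp only [mul_diagonal, transpose_apply, ukfDelta_zero, ukfDelta_left, ukfDelta_right,
    zero_mul, zero_add]
  simp only [Matrix.smul_apply, mul_apply, smul_eq_mul, transpose_apply, Finset.mul_sum]
  refine Finset.sum_congr rfl fun k _ => ?_
  simp only [ukfW, Nat.succ_ne_zero, if_false]
  field_simp
  ring

lemma propagate_sigmaPts {n : ℕ} (A : Matrix (Fin n) (Fin n) ℝ) (u xhat : Fin n → ℝ) (α : ℝ)
    (B : Matrix (Fin n) (Fin n) ℝ) :
    propagate A u (sigmaPts xhat α B) =
      A * ukfDelta n α B + vecMulVec (A *ᵥ xhat + u) (fun _ => 1) := by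
  ext i j
  simp only [propagate, sigmaPts, of_apply, mulVec, dotProduct, Matrix.add_apply, mul_apply,
    vecMulVec_apply, Pi.add_apply, mul_one, mul_add, Finset.sum_add_distrib]
  ring

lemma devMat_mul {q r m : ℕ} (w : Fin m → ℝ) (M : Matrix (Fin q) (Fin r) ℝ)
    (X : Matrix (Fin r) (Fin m) ℝ) : devMat w (M * X) = M * devMat w X := by
  simp only [devMat, Matrix.mul_sub, mul_vecMulVec, mulVec_mulVec]

lemma devMat_add_vecMulVec_one {q m : ℕ} {w : Fin m → ℝ} (hw : ∑ j, w j = 1)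
    {D : Matrix (Fin q) (Fin m) ℝ} (hD : D *ᵥ w = 0) (v : Fin q → ℝ) :
    devMat w (D + vecMulVec v (fun _ => 1)) = D := by
  have hv : vecMulVec v (fun _ => 1) *ᵥ w = v := by
    ext i
    simp [mulVec, dotProduct, vecMulVec_apply, ← Finset.mul_sum, hw]
  rw [devMat, add_mulVec, hD, hv, zero_add, add_sub_cancel_right]

theorem stmt13 {n p : ℕ} (hn : 0 < n) (hp : 0 < p)
    (A : Matrix (Fin n) (Fin n) ℝ) (C : Matrix (Fin p) (Fin n) ℝ)
    (Q P : Matrix (Fin n) (Fin n) ℝ) (R : Matrix (Fin p) (Fin p) ℝ)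
    (hQ : Q.PosSemidef) (hR : R.PosDef) (hP : P.PosSemidef)
    (xhat u : Fin n → ℝ) (α : ℝ) (hα : α ≠ 0)
    (B : Matrix (Fin n) (Fin n) ℝ) (hB : B * Bᵀ = (n : ℝ) • P)
    (X' : Matrix (Fin n) (Fin (2*n+1)) ℝ) (hX' : X' = propagate A u (sigmaPts xhat α B))
    (Xt : Matrix (Fin n) (Fin (2*n+1)) ℝ) (hXt : Xt = devMat (ukfW n α) X')
    (Yt : Matrix (Fin p) (Fin (2*n+1)) ℝ) (hYt : Yt = devMat (ukfW n α) (C * X')) :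
    (Yt * Matrix.diagonal (ukfW n α) * Ytᵀ + R).PosDef ∧
    Yt * Matrix.diagonal (ukfW n α) * Ytᵀ + R = C * A * P * Aᵀ * Cᵀ + R ∧
    (Xt * Matrix.diagonal (ukfW n α) * Ytᵀ) *
        (Yt * Matrix.diagonal (ukfW n α) * Ytᵀ + R)⁻¹ =
      ((A * P * Aᵀ + Q) * Cᵀ - Q * Cᵀ) *
        (C * (A * P * Aᵀ + Q) * Cᵀ + R - C * Q * Cᵀ)⁻¹ := by
  have hn' : (n : ℝ) ≠ 0 := by exact_mod_cast hn.ne'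
  have hD : ukfDelta n α B * diagonal (ukfW n α) * (ukfDelta n α B)ᵀ = P := by
    rw [ukfDelta_mul_diagonal_mul_transpose hn hα, hB, smul_smul, inv_mul_cancel₀ hn', one_smul]
  have hX : Xt = A * ukfDelta n α B := by
    rw [hXt, hX', propagate_sigmaPts]
    refine devMat_add_vecMulVec_one (sum_ukfW hn hα) ?_ _
    rw [← mulVec_mulVec, ukfDelta_mulVec_ukfW, mulVec_zero]
  have hY : Yt = C * Xt := by rw [hYt, hXt, devMat_mul]
  have hXX : Xt * diagonal (ukfW n α) * Xtᵀ = A * P * Aᵀ := by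
    rw [hX, ← hD, transpose_mul]
    simp only [Matrix.mul_assoc]
  have hXY : Xt * diagonal (ukfW n α) * Ytᵀ = A * P * Aᵀ * Cᵀ := by
    rw [hY, transpose_mul, ← Matrix.mul_assoc, hXX]
  have hYY : Yt * diagonal (ukfW n α) * Ytᵀ = C * A * P * Aᵀ * Cᵀ := by
    rw [Matrix.mul_assoc, hY, Matrix.mul_assoc, ← hY, ← Matrix.mul_assoc Xt, hXY]
    simp only [Matrix.mul_assoc]
  have hpsd : (C * A * P * Aᵀ * Cᵀ).PosSemidef := by
    simpa [Matrix.mul_assoc] using hP.mul_mul_conjTranspose_same (C * A)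
  refine ⟨?_, by rw [hYY], ?_⟩
  · rw [hYY]
    exact PosDef.posSemidef_add hpsd hR
  · rw [hYY, hXY]
    congr 2
    · rw [Matrix.add_mul, add_sub_cancel_right]
    · simp only [Matrix.mul_add, Matrix.add_mul, Matrix.mul_assoc]
      abel
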